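/- Let p>1 and let w be a weight on a dyadic interval J with [w]_{RH_p^d(J)} = δ and Q := max{Db^d(w), 2}. Let ε = ε(p,δ,Q) and s^- := u^-(1/ε). Then for every q > 1 − p·s^-, the weight w^p belongs to the dyadic Muckenhoupt class A_q^d on J, and moreover [w^p]_{A_q^d(J)} ≤ ((q−1)/(q−1+p·s^-))^{q−1}. -/

import Mathlib

open MeasureTheory Set

/-- The dyadic interval `[n·2^(-k), (n+1)·2^(-k)]`. -/
noncomputable def dIcc (n k : ℕ) : Set ℝ :=
  Set.Icc ((n : ℝ) * 2 ^ (-(k : ℤ))) (((n : ℝ) + 1) * 2 ^ (-(k : ℤ)))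

/-- The average `⟨f⟩_I` of `f` over the dyadic interval `I = [n·2^(-k), (n+1)·2^(-k)]`. -/
noncomputable def avg (f : ℝ → ℝ) (n k : ℕ) : ℝ :=
  (2 : ℝ) ^ (k : ℤ) * ∫ x in dIcc n k, f x


noncomputable def psiB (p x1 a : ℝ) : ℝ := p * x1 * a ^ (p - 1) - (p - 1) * a ^ p

noncomputable def FB (p r x1 Z a : ℝ) : ℝ :=
  -(p - 1) / r * a ^ r + p * x1 / (r - 1) * a ^ (r - 1) - Z / (r - p) * a ^ (r - p)

lemma psiB_deriv {p x1 a : ℝ} (ha : 0 < a) :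
    HasDerivAt (psiB p x1) (p * (p - 1) * a ^ (p - 1 - 1) * (x1 - a)) a := by
  have h1 := (Real.hasDerivAt_rpow_const (x := a) (p := p - 1) (Or.inl ha.ne')).const_mul (p * x1)
  have h2 := (Real.hasDerivAt_rpow_const (x := a) (p := p) (Or.inl ha.ne')).const_mul (p - 1)
  have h3 := h1.sub h2
  refine h3.congr_deriv ?_
  have : a ^ (p - 1) = a ^ (p - 1 - 1) * a := by
    rw [← Real.rpow_add_one ha.ne']; congr 1; ring
  rw [this]; ring

lemma psiB_mono {p x1 b y : ℝ} (hp : 1 < p) (hb : 0 < b) (hby : b ≤ y) (hy : y ≤ x1) :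
    psiB p x1 b ≤ psiB p x1 y := by
  have : MonotoneOn (psiB p x1) (Icc b y) := by
    apply monotoneOn_of_hasDerivWithinAt_nonneg (convex_Icc b y)
      (f' := fun a => p * (p - 1) * a ^ (p - 1 - 1) * (x1 - a))
    · intro a ha
      exact (psiB_deriv (hb.trans_le ha.1)).continuousAt.continuousWithinAt
    · intro a ha
      rw [interior_Icc] at ha
      exact (psiB_deriv (hb.trans ha.1)).hasDerivWithinAt
    · intro a ha
      rw [interior_Icc] at ha
      have h0 : 0 < a := hb.trans ha.1
      have := Real.rpow_pos_of_pos h0 (p - 1 - 1)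
      have h1 : 0 ≤ x1 - a := by linarith [ha.2]
      have h2 : 0 ≤ p - 1 := by linarith
      positivity
  exact this ⟨le_rfl, hby⟩ ⟨hby, le_rfl⟩ hby

lemma psiB_anti {p x1 b y : ℝ} (hp : 1 < p) (hx : 0 < x1) (hb : x1 ≤ b) (hby : b ≤ y) :
    psiB p x1 y ≤ psiB p x1 b := by
  have : AntitoneOn (psiB p x1) (Icc b y) := by
    apply antitoneOn_of_hasDerivWithinAt_nonpos (convex_Icc b y)
      (f' := fun a => p * (p - 1) * a ^ (p - 1 - 1) * (x1 - a))
    · intro a ha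
      exact (psiB_deriv (hx.trans_le (hb.trans ha.1))).continuousAt.continuousWithinAt
    · intro a ha
      rw [interior_Icc] at ha
      exact (psiB_deriv (hx.trans_le (hb.trans ha.1.le))).hasDerivWithinAt
    · intro a ha
      rw [interior_Icc] at ha
      have h0 : 0 < a := (hx.trans_le (hb.trans ha.1.le))
      have := Real.rpow_pos_of_pos h0 (p - 1 - 1)
      have h1 : x1 - a ≤ 0 := by linarith [ha.1]
      have h2 : 0 ≤ p - 1 := by linarith
      exact mul_nonpos_of_nonneg_of_nonpos (by positivity) h1
  exact this ⟨le_rfl, hby⟩ ⟨hby, le_rfl⟩ hby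

lemma FB_deriv {p r x1 Z a : ℝ} (hp : 1 < p) (hr : r < 0) (ha : 0 < a) :
    HasDerivAt (FB p r x1 Z) (a ^ (r - p - 1) * (psiB p x1 a - Z)) a := by
  have h1 := (Real.hasDerivAt_rpow_const (x := a) (p := r) (Or.inl ha.ne')).const_mul (-(p - 1) / r)
  have h2 := (Real.hasDerivAt_rpow_const (x := a) (p := r - 1) (Or.inl ha.ne')).const_mul
    (p * x1 / (r - 1))
  have h3 := (Real.hasDerivAt_rpow_const (x := a) (p := r - p) (Or.inl ha.ne')).const_mul
    (Z / (r - p))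
  refine ((h1.add h2).sub h3).congr_deriv ?_
  have e1 : a ^ (r - 1) = a ^ (r - p - 1) * a ^ p := by
    rw [← Real.rpow_add ha]; congr 1; ring
  have e2 : a ^ (r - 1 - 1) = a ^ (r - p - 1) * a ^ (p - 1) := by
    rw [← Real.rpow_add ha]; congr 1; ring
  rw [e1, e2, psiB]
  have n1 : r ≠ 0 := hr.ne
  have n2 : r - 1 ≠ 0 := by linarith
  have n3 : r - p ≠ 0 := by linarith
  field_simp
  ring

lemma FB_min {p r x1 Z a b : ℝ} (hp : 1 < p) (hr : r < 0) (hb : 0 < b) (hbx : b ≤ x1)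
    (hZ : psiB p x1 b = Z) (ha : 0 < a) (h : a ≤ x1 ∨ Z ≤ psiB p x1 a) :
    FB p r x1 Z b ≤ FB p r x1 Z a := by
  have hx : 0 < x1 := hb.trans_le hbx
  rcases le_total a b with hab | hab
  · have : AntitoneOn (FB p r x1 Z) (Icc a b) := by
      apply antitoneOn_of_hasDerivWithinAt_nonpos (convex_Icc a b)
        (f' := fun a => a ^ (r - p - 1) * (psiB p x1 a - Z))
      · intro y hy
        exact (FB_deriv hp hr (ha.trans_le hy.1)).continuousAt.continuousWithinAt
      · intro y hy
        rw [interior_Icc] at hy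
        exact (FB_deriv hp hr (ha.trans hy.1)).hasDerivWithinAt
      · intro y hy
        rw [interior_Icc] at hy
        have h0 : 0 < y := ha.trans hy.1
        have := psiB_mono hp h0 hy.2.le hbx
        exact mul_nonpos_of_nonneg_of_nonpos (Real.rpow_nonneg h0.le _) (by linarith)
    exact this ⟨le_rfl, hab⟩ ⟨hab, le_rfl⟩ hab
  · have : MonotoneOn (FB p r x1 Z) (Icc b a) := by
      apply monotoneOn_of_hasDerivWithinAt_nonneg (convex_Icc b a)
        (f' := fun a => a ^ (r - p - 1) * (psiB p x1 a - Z))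
      · intro y hy
        exact (FB_deriv hp hr (hb.trans_le hy.1)).continuousAt.continuousWithinAt
      · intro y hy
        rw [interior_Icc] at hy
        exact (FB_deriv hp hr (hb.trans hy.1)).hasDerivWithinAt
      · intro y hy
        rw [interior_Icc] at hy
        have h0 : 0 < y := hb.trans hy.1
        refine mul_nonneg (Real.rpow_nonneg h0.le _) ?_
        rcases le_total y x1 with hyx | hyx
        · have := psiB_mono hp hb hy.1.le hyx
          linarith
        · rcases h with h | h
          · linarith [hy.2]
          · have := psiB_anti hp hx hyx hy.2.le
            linarith
    exact this ⟨le_rfl, hab⟩ ⟨hab, le_rfl⟩ hab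

/-- on the tangent line, `FB` simplifies -/
lemma FB_eq {p r x1 a : ℝ} (hp : 1 < p) (hr : r < 0) (ha : 0 < a) :
    FB p r x1 (psiB p x1 a) a =
      p * (p - 1) / ((p - r) * (-r) * (1 - r)) * (a ^ r * (1 + r * (x1 / a - 1))) := by
  have e1 : a ^ (r - 1) = a ^ r / a := by
    rw [Real.rpow_sub ha, Real.rpow_one]
  have e2 : a ^ (p - 1) = a ^ p / a := by
    rw [Real.rpow_sub ha, Real.rpow_one]
  have e3 : a ^ (r - p) = a ^ r / a ^ p := by
    rw [Real.rpow_sub ha]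
  rw [FB, psiB, e1, e2, e3]
  have n1 : r ≠ 0 := hr.ne
  have n2 : r - 1 ≠ 0 := by linarith
  have n2' : 1 - r ≠ 0 := by linarith
  have n3 : r - p ≠ 0 := by linarith
  have n3' : p - r ≠ 0 := by linarith
  have := (Real.rpow_pos_of_pos ha p).ne'
  have d1 : r - 1 = -(1 - r) := by ring
  have d3 : r - p = -(p - r) := by ring
  rw [d1, d3]
  field_simp
  ring

lemma tangent_rpow {p t t0 : ℝ} (hp : 1 ≤ p) (ht : 0 < t) (ht0 : 0 < t0) :
    t0 ^ p + p * t0 ^ (p - 1) * (t - t0) ≤ t ^ p := by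
  have h := one_add_mul_self_le_rpow_one_add (s := t / t0 - 1) (p := p)
    (by have := div_pos ht ht0; linarith) hp
  have h2 : (1 + (t / t0 - 1)) ^ p = t ^ p / t0 ^ p := by
    rw [add_sub_cancel, Real.div_rpow ht.le ht0.le]
  rw [h2, le_div_iff₀ (Real.rpow_pos_of_pos ht0 p)] at h
  rw [Real.rpow_sub ht0, Real.rpow_one]
  calc _ = (1 + p * (t / t0 - 1)) * t0 ^ p := by field_simp
    _ ≤ _ := h

lemma chord_one {p H t cp : ℝ} (hp : 1 < p) (hH : p < H) (ht : 0 < t)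
    (hc : cp = (H / p) ^ p * ((p - 1) / (H - 1)) ^ (p - 1)) :
    1 + H * (t - 1) ≤ cp * t ^ p := by
  have hp1 : 0 < p - 1 := by linarith
  have hH1 : 0 < H - 1 := by linarith
  have hH0 : 0 < H := by linarith
  have hp0 : 0 < p := by linarith
  set t0 := (H / p)⁻¹ * ((p - 1) / (H - 1))⁻¹ with ht0
  have h0 : 0 < t0 := by positivity
  have hcp : cp * t0 ^ (p - 1) = H / p := by
    rw [hc, ht0, Real.mul_rpow (by positivity) (by positivity), Real.inv_rpow (by positivity),
      Real.inv_rpow (by positivity)]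
    have a1 := (Real.rpow_pos_of_pos (show 0 < (p - 1) / (H - 1) by positivity) (p - 1)).ne'
    have a2 := (Real.rpow_pos_of_pos (show 0 < H / p by positivity) (p - 1)).ne'
    have : (H / p) ^ p = (H / p) ^ (p - 1) * (H / p) := by
      rw [← Real.rpow_add_one (by positivity)]; congr 1; ring
    rw [this]
    field_simp
  have hcpos : 0 < cp := by rw [hc]; positivity
  have h := tangent_rpow hp.le ht h0
  have e : t0 ^ p = t0 ^ (p - 1) * t0 := by
    rw [← Real.rpow_add_one h0.ne']; congr 1; ring
  rw [e] at h
  have h' := mul_le_mul_of_nonneg_left h hcpos.le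
  refine le_trans (le_of_eq ?_) h'
  calc 1 + H * (t - 1) = (H / p) * t0 + p * (H / p) * (t - t0) := by
        rw [ht0]; field_simp; ring
    _ = _ := by rw [← hcp]; ring

lemma cp_gt_one {p H cp : ℝ} (hp : 1 < p) (hH : p < H) 
    (hc : cp = (H / p) ^ p * ((p - 1) / (H - 1)) ^ (p - 1)) : 1 < cp := by
  -- strict: use t slightly bigger than one : cp t^p >= 1 + H (t-1), deriv contradiction
  by_contra hcon
  push Not at hcon
  have hder : HasDerivAt (fun t : ℝ => t ^ p - (1 + H * (t - 1))) (p - H) 1 := by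
    have h1 := Real.hasDerivAt_rpow_const (x := 1) (p := p) (Or.inl one_ne_zero)
    have h2 := (((hasDerivAt_id (1:ℝ)).sub_const 1).const_mul H).const_add 1
    have := h1.sub h2
    refine this.congr_deriv (by simp)
  have hmin : IsLocalMin (fun t : ℝ => t ^ p - (1 + H * (t - 1))) 1 := by
    filter_upwards [lt_mem_nhds (zero_lt_one)] with t ht
    have := chord_one hp hH ht hc
    have h3 := Real.rpow_pos_of_pos ht p
    simp
    nlinarith
  have := hmin.hasDerivAt_eq_zero hder
  linarith

/-- slopes of chords of `t^p` from 1 -/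
lemma chord_slope_mono {p R Q : ℝ} (hp : 1 < p) (hR : 1 < R) (hRQ : R ≤ Q) :
    (R ^ p - 1) / (R - 1) ≤ (Q ^ p - 1) / (Q - 1) := by
  rcases hRQ.eq_or_lt with h | h
  · rw [h]
  have := (convexOn_rpow hp.le).secant_mono (a := 1) (x := R) (y := Q) (by simp)
    (by simp; linarith) (by simp; linarith) hR.ne' (by linarith) hRQ
  simpa using this

lemma H_gt {p Q : ℝ} (hp : 1 < p) (hQ : 2 ≤ Q) : p < (Q ^ p - 1) / (Q - 1) := by
  rw [lt_div_iff₀ (by linarith)]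
  have := one_add_mul_self_lt_rpow_one_add (s := Q - 1) (p := p) (by linarith) (by linarith) hp
  rw [add_sub_cancel] at this
  linarith

lemma chord_bound {p Q H cp D z1 z2 x1 x2 a : ℝ} (hp : 1 < p) (hQ : 2 ≤ Q)
    (hH : H = (Q ^ p - 1) / (Q - 1))
    (hc : cp = (H / p) ^ p * ((p - 1) / (H - 1)) ^ (p - 1))
    (hz : 0 < z1) (hza : z1 < a) (hax : a < x1) (hxQ : x1 ≤ Q * z1) (hD : 0 ≤ D)
    (hz2 : z2 ≤ D * z1 ^ p) (hx2 : x2 ≤ D * x1 ^ p) :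
    (x1 - a) * z2 + (a - z1) * x2 ≤ (x1 - z1) * (cp * D * a ^ p) := by
  have hHp : p < H := hH ▸ H_gt hp hQ
  set t := a / z1
  set R := x1 / z1
  have ht : 1 < t := (one_lt_div hz).2 hza
  have hRt : t < R := div_lt_div_of_pos_right hax hz
  have hRQ : R ≤ Q := (div_le_iff₀ hz).2 hxQ
  have ha : a = t * z1 := by simp only [t]; field_simp
  have hx : x1 = R * z1 := by simp only [R]; field_simp
  have h1 := chord_slope_mono hp (ht.trans hRt) hRQ
  rw [← hH, div_le_iff₀ (by linarith)] at h1
  have h2 := chord_one hp hHp (show 0 < t by linarith) hc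
  have hzp := Real.rpow_pos_of_pos hz p
  have key : (R - t) + (t - 1) * R ^ p ≤ (R - 1) * (cp * t ^ p) := by
    nlinarith
  calc (x1 - a) * z2 + (a - z1) * x2 
      ≤ (x1 - a) * (D * z1 ^ p) + (a - z1) * (D * x1 ^ p) := by
        gcongr <;> linarith
    _ = (z1 * D * z1 ^ p) * ((R - t) + (t - 1) * R ^ p) := by
        rw [ha, hx, Real.mul_rpow (by linarith) hz.le]; ring
    _ ≤ (z1 * D * z1 ^ p) * ((R - 1) * (cp * t ^ p)) := by gcongr
    _ = _ := by
        rw [ha, hx, Real.mul_rpow (by linarith) hz.le]; ring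

lemma exists_tangent {p κ E x1 x2 : ℝ} (hp : 1 < p) (hκ : 1 ≤ κ) (hE : 0 < E)
    (hκE : κ ^ p = E * (p * κ - (p - 1))) (hx : 0 < x1) (h1 : x1 ^ p ≤ x2)
    (h2 : x2 ≤ E * x1 ^ p) :
    ∃ a, 0 < a ∧ a ≤ x1 ∧ x1 ≤ κ * a ∧ psiB p x1 a = x2 / E := by
  have hκ0 : 0 < κ := by linarith
  have hl : 0 < x1 / κ := by positivity
  have hle : x1 / κ ≤ x1 := div_le_self hx.le hκ
  have hcont : ContinuousOn (psiB p x1) (Icc (x1 / κ) x1) := fun a ha =>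
    (psiB_deriv (hl.trans_le ha.1)).continuousAt.continuousWithinAt
  have e1 : psiB p x1 (x1 / κ) ≤ x2 / E := by
    rw [le_div_iff₀ hE]
    refine le_trans (le_of_eq ?_) h1
    rw [psiB, Real.rpow_sub hl, Real.rpow_one, Real.div_rpow hx.le hκ0.le, hκE]
    have : p * κ - (p - 1) ≠ 0 := by nlinarith
    field_simp
  have e2 : x2 / E ≤ psiB p x1 x1 := by
    rw [div_le_iff₀ hE]
    refine le_trans h2 (le_of_eq ?_)
    rw [psiB, Real.rpow_sub hx, Real.rpow_one]
    field_simp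
    ring
  obtain ⟨a, ha, hae⟩ := intermediate_value_Icc hle hcont ⟨e1, e2⟩
  refine ⟨a, hl.trans_le ha.1, ha.2, ?_, hae⟩
  have := (div_le_iff₀ hκ0).1 ha.1
  linarith

lemma lower_aux {r κ y : ℝ} (hr : r < 0) (hy : 1 ≤ y) (hyκ : y ≤ κ) (hC : 0 < 1 + r * (κ - 1)) :
    (1 + r * (κ - 1)) * y ^ r ≤ κ ^ r * (1 + r * (y - 1)) := by
  have hy0 : 0 < y := by linarith
  set g := κ / y
  have hg : 1 ≤ g := (one_le_div hy0).2 hyκ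
  have hg0 : 0 < g := by linarith
  have hκ : κ = g * y := by simp only [g]; field_simp
  have hb : 1 + r * (g - 1) ≤ g ^ r := by
    rw [Real.rpow_def_of_pos hg0]
    have h1 := Real.add_one_le_exp (Real.log g * r)
    have h2 := Real.log_le_sub_one_of_pos hg0
    nlinarith
  have hpos : 0 < 1 + r * (y - 1) := by nlinarith
  rw [hκ] at hC ⊢
  rw [Real.mul_rpow hg0.le hy0.le]
  have hyr := Real.rpow_pos_of_pos hy0 r
  have h3 : (1 + r * (g - 1)) * (1 + r * (y - 1)) ≤ g ^ r * (1 + r * (y - 1)) := by gcongr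
  have h4 : 0 ≤ (g - 1) * (y - 1) := mul_nonneg (by linarith) (by linarith)
  have h5 : 1 + r * (g * y - 1) ≤ (1 + r * (g - 1)) * (1 + r * (y - 1)) := by
    nlinarith [mul_nonneg (sq_nonneg r) h4, mul_nonneg (neg_nonneg.2 hr.le) h4]
  calc _ ≤ (g ^ r * (1 + r * (y - 1))) * y ^ r := by
        gcongr; linarith
    _ = _ := by ring

lemma upper_aux {p r κ E x1 x2 a : ℝ} (hp : 1 < p) (hr : r < 0) (hκ : 1 ≤ κ) (hE : 0 < E)
    (hκE : κ ^ p = E * (p * κ - (p - 1))) (hx2 : 0 < x2) (ha : 0 < a) (hax : a ≤ x1)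
    (hxa : x1 ≤ κ * a) (he : psiB p x1 a = x2 / E) :
    κ ^ r * (a ^ r * (1 + r * (x1 / a - 1))) ≤ x2 ^ (r / p) := by
  have hκ0 : 0 < κ := by linarith
  have hp0 : 0 < p := by linarith
  have hle : x2 ≤ (κ * a) ^ p := by
    rw [eq_div_iff hE.ne', psiB] at he
    rw [← he, Real.mul_rpow hκ0.le ha.le, hκE, Real.rpow_sub ha, Real.rpow_one]
    have := Real.rpow_pos_of_pos ha p
    have h3 : x1 / a ≤ κ := (div_le_iff₀ ha).2 hxa
    calc (p * x1 * (a ^ p / a) - (p - 1) * a ^ p) * E = E * a ^ p * (p * (x1 / a) - (p - 1)) := by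
          ring
      _ ≤ E * a ^ p * (p * κ - (p - 1)) := by gcongr
      _ = _ := by ring
  have h1 : (κ * a) ^ r ≤ x2 ^ (r / p) := by
    have := Real.rpow_le_rpow_of_nonpos hx2 hle (show r / p ≤ 0 from (div_neg_of_neg_of_pos hr hp0).le)
    rw [← Real.rpow_mul (by positivity)] at this
    have e : p * (r / p) = r := by field_simp
    rwa [e] at this
  refine le_trans ?_ h1
  rw [Real.mul_rpow hκ0.le ha.le]
  have h2 : 1 + r * (x1 / a - 1) ≤ 1 := by
    have : 1 ≤ x1 / a := (one_le_div ha).2 hax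
    nlinarith
  have := Real.rpow_pos_of_pos hκ0 r
  have := Real.rpow_pos_of_pos ha r
  calc _ = κ ^ r * a ^ r * (1 + r * (x1 / a - 1)) := by ring
    _ ≤ κ ^ r * a ^ r * 1 := by gcongr
    _ = _ := by ring

lemma bellman {p r κ E D Q H cp : ℝ} (hp : 1 < p) (hr : r < 0) (hκ : 1 ≤ κ) (hD : 0 < D)
    (hQ : 2 ≤ Q) (hH : H = (Q ^ p - 1) / (Q - 1))
    (hc : cp = (H / p) ^ p * ((p - 1) / (H - 1)) ^ (p - 1)) (hED : E = cp * D)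
    (hκE : κ ^ p = E * (p * κ - (p - 1))) (hC : 0 < 1 + r * (κ - 1)) :
    ∃ B : ℝ → ℝ → ℝ,
      (∀ x1 x2, 0 < x1 → x1 ^ p ≤ x2 → x2 ≤ D * x1 ^ p →
        x1 ^ r ≤ B x1 x2 ∧ B x1 x2 ≤ (1 + r * (κ - 1))⁻¹ * x2 ^ (r / p)) ∧
      (∀ x1 x2 z1 z2 y1 y2, x1 = (z1 + y1) / 2 → x2 = (z2 + y2) / 2 →
        0 < x1 → x1 ^ p ≤ x2 → x2 ≤ D * x1 ^ p →
        0 < z1 → z1 ^ p ≤ z2 → z2 ≤ D * z1 ^ p →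
        0 < y1 → y1 ^ p ≤ y2 → y2 ≤ D * y1 ^ p →
        x1 ≤ Q * z1 → x1 ≤ Q * y1 → (B z1 z2 + B y1 y2) / 2 ≤ B x1 x2) := by
  have hHp : p < H := hH ▸ H_gt hp hQ
  have hcp := cp_gt_one hp hHp hc
  have hE : 0 < E := by rw [hED]; positivity
  have hκ0 : 0 < κ := by linarith
  have hex : ∀ x1 x2 : ℝ, ∃ a, 0 < x1 → x1 ^ p ≤ x2 → x2 ≤ D * x1 ^ p →
      (0 < a ∧ a < x1 ∧ x1 ≤ κ * a ∧ psiB p x1 a = x2 / E) := by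
    intro x1 x2
    by_cases h : 0 < x1 ∧ x1 ^ p ≤ x2 ∧ x2 ≤ D * x1 ^ p
    · obtain ⟨h0, h1, h2⟩ := h
      have hxp := Real.rpow_pos_of_pos h0 p
      have hlt : x2 < E * x1 ^ p := by
        refine lt_of_le_of_lt h2 ?_
        rw [hED]
        have : D < cp * D := by nlinarith
        gcongr
      obtain ⟨a, h3, h4, h5, h6⟩ := exists_tangent hp hκ hE hκE h0 h1 hlt.le
      refine ⟨a, fun _ _ _ => ⟨h3, ?_, h5, h6⟩⟩
      refine lt_of_le_of_ne h4 ?_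
      rintro rfl
      rw [psiB, Real.rpow_sub h0, Real.rpow_one, eq_div_iff hE.ne'] at h6
      have : (p * a * (a ^ p / a) - (p - 1) * a ^ p) * E = E * a ^ p := by field_simp; ring
      linarith
    · exact ⟨0, fun h1 h2 h3 => absurd ⟨h1, h2, h3⟩ h⟩
  choose α hα using hex
  set G := p * (p - 1) / ((p - r) * (-r) * (1 - r)) with hG
  have hGpos : 0 < G := by
    have : 0 < p - 1 := by linarith
    have : 0 < p - r := by linarith
    have : 0 < -r := by linarith
    have : 0 < 1 - r := by linarith
    have : 0 < p := by linarith
    positivity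
  set M := (1 + r * (κ - 1))⁻¹ * κ ^ r / G with hM
  have hκr := Real.rpow_pos_of_pos hκ0 r
  have hMpos : 0 < M := by positivity
  refine ⟨fun x1 x2 => M * FB p r x1 (x2 / E) (α x1 x2), ?_, ?_⟩
  · intro x1 x2 h0 h1 h2
    obtain ⟨ha, hax, hxa, he⟩ := hα x1 x2 h0 h1 h2
    set a := α x1 x2
    have hx2 : 0 < x2 := lt_of_lt_of_le (Real.rpow_pos_of_pos h0 p) h1
    have hval : M * FB p r x1 (x2 / E) a =
        (1 + r * (κ - 1))⁻¹ * (κ ^ r * (a ^ r * (1 + r * (x1 / a - 1)))) := by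
      rw [← he, FB_eq hp hr ha, ← hG, hM]
      field_simp
    simp only []
    rw [hval]
    constructor
    · rw [← div_eq_inv_mul, le_div_iff₀ hC]
      have := lower_aux hr ((one_le_div ha).2 hax.le) ((div_le_iff₀ ha).2 hxa) hC
      have har := Real.rpow_pos_of_pos ha r
      have h4 : x1 ^ r = a ^ r * (x1 / a) ^ r := by
        rw [← Real.mul_rpow ha.le (by positivity)]; congr 1; field_simp
      rw [h4]
      calc _ = a ^ r * ((1 + r * (κ - 1)) * (x1 / a) ^ r) := by ring
        _ ≤ a ^ r * (κ ^ r * (1 + r * (x1 / a - 1))) := by gcongr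
        _ = _ := by ring
    · have := upper_aux hp hr hκ hE hκE hx2 ha hax.le hxa he
      gcongr
  · intro x1 x2 z1 z2 y1 y2 e1 e2 hx hx1 hx2 hz hz1 hz2 hy hy1 hy2 hxz hxy
    obtain ⟨ha, hax, -, hae⟩ := hα x1 x2 hx hx1 hx2
    set a := α x1 x2
    have key : ∀ v1 v2, 0 < v1 → v1 ^ p ≤ v2 → v2 ≤ D * v1 ^ p → x1 ≤ Q * v1 →
        FB p r v1 (v2 / E) (α v1 v2) ≤ FB p r v1 (v2 / E) a := by
      intro v1 v2 hv hv1 hv2 hxv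
      obtain ⟨hb, hbv, -, hbe⟩ := hα v1 v2 hv hv1 hv2
      refine FB_min hp hr hb hbv.le hbe ha ?_
      rcases le_or_gt a v1 with h | h
      · exact Or.inl h
      right
      have hch := chord_bound hp hQ hH hc hv h hax hxv hD.le hv2 hx2
      rw [← hED] at hch
      rw [eq_div_iff hE.ne'] at hae
      rw [div_le_iff₀ hE]
      have hap : a ^ (p - 1) * a = a ^ p := by
        rw [← Real.rpow_add_one ha.ne']; congr 1; ring
      rw [psiB, ← hap] at hae ⊢
      rw [← hap, ← hae] at hch
      have : (x1 - a) * (v2 - (p * v1 * a ^ (p - 1) - (p - 1) * (a ^ (p - 1) * a)) * E) ≤ 0 := by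
        linear_combination hch
      nlinarith
    have k1 := key z1 z2 hz hz1 hz2 hxz
    have k2 := key y1 y2 hy hy1 hy2 hxy
    have : FB p r x1 (x2 / E) a = (FB p r z1 (z2 / E) a + FB p r y1 (y2 / E) a) / 2 := by
      rw [e1, e2]; unfold FB; ring
    simp only []
    rw [this]
    nlinarith

lemma two_zpow_neg (k : ℕ) : (2 : ℝ) ^ (-(k : ℤ)) = (2 ^ k)⁻¹ := by
  rw [zpow_neg, zpow_natCast]

lemma dIcc_eq (n k : ℕ) : dIcc n k = Icc ((n : ℝ) / 2 ^ k) (((n : ℝ) + 1) / 2 ^ k) := by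
  rw [dIcc, two_zpow_neg, div_eq_mul_inv, div_eq_mul_inv]

lemma avg_eq (f : ℝ → ℝ) (n k : ℕ) :
    avg f n k = 2 ^ k * ∫ x in ((n : ℝ) / 2 ^ k)..(((n : ℝ) + 1) / 2 ^ k), f x := by
  rw [avg, dIcc_eq, zpow_natCast, integral_Icc_eq_integral_Ioc,
    intervalIntegral.integral_of_le (by gcongr; linarith)]

lemma avg_split {f : ℝ → ℝ} (hf : LocallyIntegrable f volume) (n k : ℕ) :
    avg f n k = (avg f (2 * n) (k + 1) + avg f (2 * n + 1) (k + 1)) / 2 := by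
  have hi : ∀ a b : ℝ, IntervalIntegrable f volume a b := fun a b =>
    (hf.integrableOn_isCompact isCompact_uIcc).intervalIntegrable
  rw [avg_eq, avg_eq, avg_eq]
  have e1 : ((2 * n : ℕ) : ℝ) / 2 ^ (k + 1) = (n : ℝ) / 2 ^ k := by
    push_cast; field_simp; ring
  have e2 : (((2 * n : ℕ) : ℝ) + 1) / 2 ^ (k + 1) = ((2 * n + 1 : ℕ) : ℝ) / 2 ^ (k + 1) := by
    push_cast; rfl
  have e3 : (((2 * n + 1 : ℕ) : ℝ) + 1) / 2 ^ (k + 1) = ((n : ℝ) + 1) / 2 ^ k := by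
    push_cast; field_simp; ring
  rw [e1, e2, e3, ← intervalIntegral.integral_add_adjacent_intervals (hi _ _) (hi _ _)]
  ring

lemma dIcc_volume (n k : ℕ) : volume (dIcc n k) = ENNReal.ofReal ((2 ^ k)⁻¹) := by
  rw [dIcc_eq, Real.volume_Icc]; congr 1; field_simp; ring

lemma dIcc_ball (n k : ℕ) :
    dIcc n k = Metric.closedBall (((n : ℝ) + 1 / 2) / 2 ^ k) ((1 / 2) / 2 ^ k) := by
  rw [Real.closedBall_eq_Icc, dIcc_eq]
  congr 1 <;> ring

lemma avg_eq_average (f : ℝ → ℝ) (n k : ℕ) : avg f n k = ⨍ x in dIcc n k, f x := by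
  rw [setAverage_eq, Measure.real, dIcc_volume, ENNReal.toReal_ofReal (by positivity), avg,
    inv_inv, zpow_natCast, smul_eq_mul]

lemma integrableOn_dIcc {f : ℝ → ℝ} (hf : LocallyIntegrable f volume) (n k : ℕ) :
    IntegrableOn f (dIcc n k) volume := hf.integrableOn_isCompact isCompact_Icc

lemma avg_pos {w : ℝ → ℝ} (hw : LocallyIntegrable w volume)
    (hpos : ∀ᵐ t ∂(volume : Measure ℝ), 0 < w t) (n k : ℕ) : 0 < avg w n k := by
  rw [avg]
  refine mul_pos (by positivity) ?_
  rw [setIntegral_pos_iff_support_of_nonneg_ae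
    (ae_restrict_of_ae (hpos.mono fun t ht => ht.le)) (integrableOn_dIcc hw n k)]
  have : volume (Function.support w ∩ dIcc n k) = volume (dIcc n k) := by
    apply measure_congr
    filter_upwards [hpos] with t ht
    have h : t ∈ Function.support w := ht.ne'
    apply propext
    exact ⟨fun h' => h'.2, fun h' => ⟨h, h'⟩⟩
  rw [this, dIcc_volume, ENNReal.ofReal_pos]
  positivity

lemma avg_jensen {p : ℝ} (hp : 1 < p) {w : ℝ → ℝ} (hw : LocallyIntegrable w volume)
    (hwp : LocallyIntegrable (fun t => w t ^ p) volume)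
    (hpos : ∀ᵐ t ∂(volume : Measure ℝ), 0 < w t) (n k : ℕ) :
    (avg w n k) ^ p ≤ avg (fun t => w t ^ p) n k := by
  rw [avg_eq_average, avg_eq_average]
  have hv := dIcc_volume n k
  refine (convexOn_rpow hp.le).map_set_average_le (g := fun x : ℝ => x ^ p) 
    (Real.continuous_rpow_const (by linarith)).continuousOn isClosed_Ici ?_ ?_ 
    (ae_restrict_of_ae (hpos.mono fun t ht => ht.le)) (integrableOn_dIcc hw n k)
    (integrableOn_dIcc hwp n k)
  · rw [hv]; simp
  · rw [hv]; simp

lemma floor_mem {t : ℝ} (ht : 0 ≤ t) (k : ℕ) : t ∈ dIcc ⌊t * 2 ^ k⌋₊ k := by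
  rw [dIcc_eq]
  have h2 : (0 : ℝ) < 2 ^ k := by positivity
  refine ⟨(div_le_iff₀ h2).2 (Nat.floor_le (by positivity)), 
    (le_div_iff₀ h2).2 (Nat.lt_floor_add_one _).le⟩

lemma leb {w : ℝ → ℝ} (hw : LocallyIntegrable w volume) (k : ℕ) :
    ∀ᵐ t ∂(volume : Measure ℝ), 0 ≤ t →
      Filter.Tendsto (fun d : ℕ => avg w ⌊t * 2 ^ (k + d)⌋₊ (k + d)) Filter.atTop (nhds (w t)) := by
  filter_upwards [IsUnifLocDoublingMeasure.ae_tendsto_average volume hw 1] with t h ht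
  have := h (l := Filter.atTop) (fun d : ℕ => ((⌊t * 2 ^ (k + d)⌋₊ : ℝ) + 1 / 2) / 2 ^ (k + d))
    (fun d : ℕ => (1 / 2) / 2 ^ (k + d)) ?_ ?_
  · refine this.congr fun d => ?_
    rw [avg_eq_average, dIcc_ball]
  · refine tendsto_nhdsWithin_iff.2 ⟨?_, Filter.Eventually.of_forall fun d => ?_⟩
    · apply Filter.Tendsto.div_atTop tendsto_const_nhds
      have h1 := tendsto_pow_atTop_atTop_of_one_lt (one_lt_two (α := ℝ))
      exact h1.comp (Filter.tendsto_atTop_mono (fun d => Nat.le_add_left d k) Filter.tendsto_id)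
    · simp only [mem_Ioi]; positivity
  · refine Filter.Eventually.of_forall fun d => ?_
    rw [one_mul, ← dIcc_ball]
    exact floor_mem ht _

lemma step_bound {g b : ℕ → ℕ → ℝ} {P : ℕ → ℕ → Prop} {r : ℝ}
    (hP : ∀ n k, P n k → P (2 * n) (k + 1) ∧ P (2 * n + 1) (k + 1))
    (h0 : ∀ n k, P n k → 0 ≤ b n k)
    (h1 : ∀ n k, P n k → g n k ^ r ≤ b n k)
    (h2 : ∀ n k, P n k → (b (2 * n) (k + 1) + b (2 * n + 1) (k + 1)) / 2 ≤ b n k) (d : ℕ) :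
    ∀ n k, P n k → ∫⁻ t in Ico ((n : ℝ) / 2 ^ k) (((n : ℝ) + 1) / 2 ^ k),
      ENNReal.ofReal (g ⌊t * 2 ^ (k + d)⌋₊ (k + d) ^ r) ≤ ENNReal.ofReal ((2 ^ k)⁻¹ * b n k) := by
  induction d with
  | zero =>
    intro n k hnk
    have : ∀ t ∈ Ico ((n : ℝ) / 2 ^ k) (((n : ℝ) + 1) / 2 ^ k),
        ENNReal.ofReal (g ⌊t * 2 ^ (k + 0)⌋₊ (k + 0) ^ r) ≤ ENNReal.ofReal (b n k) := by
      intro t ht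
      have h2 : (0 : ℝ) < 2 ^ k := by positivity
      have hf : ⌊t * 2 ^ (k + 0)⌋₊ = n := by
        rw [add_zero]
        have ha := (div_le_iff₀ h2).1 ht.1
        have hb := (lt_div_iff₀ h2).1 ht.2
        rw [Nat.floor_eq_iff (le_trans (by positivity) ha)]
        exact ⟨ha, hb⟩
      rw [hf]
      exact ENNReal.ofReal_le_ofReal (h1 n k hnk)
    refine (setLIntegral_mono measurable_const this).trans ?_
    rw [setLIntegral_const, Real.volume_Ico, ← ENNReal.ofReal_mul (h0 n k hnk)]
    refine ENNReal.ofReal_le_ofReal (le_of_eq ?_)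
    field_simp; ring
  | succ d ih =>
    intro n k hnk
    obtain ⟨p1, p2⟩ := hP n k hnk
    have i1 := ih _ _ p1
    have i2 := ih _ _ p2
    have e1 : ((2 * n : ℕ) : ℝ) / 2 ^ (k + 1) = (n : ℝ) / 2 ^ k := by
      push_cast; field_simp; ring
    have e2 : (((2 * n : ℕ) : ℝ) + 1) / 2 ^ (k + 1) = ((2 * n + 1 : ℕ) : ℝ) / 2 ^ (k + 1) := by
      push_cast; rfl
    have e3 : (((2 * n + 1 : ℕ) : ℝ) + 1) / 2 ^ (k + 1) = ((n : ℝ) + 1) / 2 ^ k := by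
      push_cast; field_simp; ring
    rw [e2, e1] at i1
    rw [e3] at i2
    have ek : k + (d + 1) = k + 1 + d := by ring
    rw [ek]
    have l1 : (n : ℝ) / 2 ^ k ≤ ((2 * n + 1 : ℕ) : ℝ) / 2 ^ (k + 1) := by
      rw [← e1]; gcongr; linarith
    have l2 : ((2 * n + 1 : ℕ) : ℝ) / 2 ^ (k + 1) ≤ ((n : ℝ) + 1) / 2 ^ k := by
      rw [← e3]; gcongr; linarith
    rw [← Ico_union_Ico_eq_Ico l1 l2]
    refine (lintegral_union_le _ _ _).trans ((add_le_add i1 i2).trans ?_)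
    have q1 := h0 _ _ p1
    have q2 := h0 _ _ p2
    rw [← ENNReal.ofReal_add (by positivity) (by positivity)]
    refine ENNReal.ofReal_le_ofReal ?_
    have := h2 n k hnk
    calc _ = (2 ^ k)⁻¹ * ((b (2 * n) (k + 1) + b (2 * n + 1) (k + 1)) / 2) := by
          rw [pow_succ]; field_simp
      _ ≤ _ := by gcongr

lemma limit_bound {w : ℝ → ℝ} (hw : LocallyIntegrable w volume)
    (hpos : ∀ᵐ t ∂(volume : Measure ℝ), 0 < w t) {r c : ℝ} (n k : ℕ) (hc : 0 ≤ c)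
    (h : ∀ d, ∫⁻ t in Ico ((n : ℝ) / 2 ^ k) (((n : ℝ) + 1) / 2 ^ k),
      ENNReal.ofReal (avg w ⌊t * 2 ^ (k + d)⌋₊ (k + d) ^ r) ≤ ENNReal.ofReal ((2 ^ k)⁻¹ * c)) :
    IntegrableOn (fun t => w t ^ r) (dIcc n k) volume ∧ avg (fun t => w t ^ r) n k ≤ c := by
  have hμ : volume.restrict (dIcc n k) =
      volume.restrict (Ico ((n : ℝ) / 2 ^ k) (((n : ℝ) + 1) / 2 ^ k)) := by
    rw [dIcc_eq]; exact (restrict_Ico_eq_restrict_Icc).symm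
  have hfat : ∫⁻ t in dIcc n k, ENNReal.ofReal (w t ^ r) ≤ ENNReal.ofReal ((2 ^ k)⁻¹ * c) := by
    rw [hμ]
    have hae : ∀ᵐ t ∂(volume.restrict (Ico ((n : ℝ) / 2 ^ k) (((n : ℝ) + 1) / 2 ^ k))),
        ENNReal.ofReal (w t ^ r) = Filter.liminf (fun d : ℕ =>
          ENNReal.ofReal (avg w ⌊t * 2 ^ (k + d)⌋₊ (k + d) ^ r)) Filter.atTop := by
      filter_upwards [ae_restrict_of_ae (leb hw k), ae_restrict_of_ae hpos,
        ae_restrict_mem measurableSet_Ico] with t h1 h2 h3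
      have h4 := h1 (le_trans (by positivity) h3.1)
      have h5 := ENNReal.tendsto_ofReal (h4.rpow_const (p := r) (Or.inl h2.ne'))
      exact h5.liminf_eq.symm
    rw [lintegral_congr_ae hae]
    refine (lintegral_liminf_le fun d => ?_).trans ?_
    · have : Measurable fun t : ℝ => ⌊t * 2 ^ (k + d)⌋₊ :=
        Nat.measurable_floor.comp (measurable_id.mul_const _)
      exact (measurable_from_top (f := fun N : ℕ =>
        ENNReal.ofReal (avg w N (k + d) ^ r))).comp this
    · exact (Filter.liminf_le_liminf (Filter.Eventually.of_forall h)).trans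
        (by rw [Filter.liminf_const])
  have hnn : 0 ≤ᵐ[volume.restrict (dIcc n k)] fun t => w t ^ r :=
    ae_restrict_of_ae (hpos.mono fun t ht => Real.rpow_nonneg ht.le r)
  have hm : AEStronglyMeasurable (fun t => w t ^ r) (volume.restrict (dIcc n k)) :=
    ((integrableOn_dIcc hw n k).aestronglyMeasurable.aemeasurable.pow_const r).aestronglyMeasurable
  have hint : IntegrableOn (fun t => w t ^ r) (dIcc n k) volume := by
    refine ⟨hm, (hasFiniteIntegral_iff_ofReal hnn).2 (hfat.trans_lt ENNReal.ofReal_lt_top)⟩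
  refine ⟨hint, ?_⟩
  rw [← ofReal_integral_eq_lintegral_ofReal hint hnn,
    ENNReal.ofReal_le_ofReal_iff (by positivity)] at hfat
  rw [avg, zpow_natCast]
  calc _ ≤ (2:ℝ) ^ k * ((2 ^ k)⁻¹ * c) := by gcongr
    _ = c := by field_simp

/-- **`RH_p` vs `A_q` for `w^p`.**  Let `p>1` and let `w` be a weight on the
dyadic interval `J = [N·2^(-K), (N+1)·2^(-K)]` with `[w]_{RH_p^d(J)} = δ` and
`Q = max{Db^d(w), 2}`.  With `H = (Q^p−1)/(Q−1)`, `ε = (H/p)·((p−1)/(H−1))^((p−1)/p)·δ`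
and `s⁻ = u⁻(1/ε)` (the solution `sm ≤ 0` of `(1−p·sm)^(1/p)(1−sm)⁻¹ = 1/ε`),
for every `q > 1 − p·s⁻` the weight `w^p` belongs to `A_q^d(J)`, and moreover
`[w^p]_{A_q^d(J)} ≤ ((q−1)/(q−1+p·s⁻))^(q−1)`. -/
theorem stmt2 (p δ Q0 Q H ε sm : ℝ) (hp : 1 < p)
    (N K : ℕ) (w : ℝ → ℝ)
    (hw_loc : LocallyIntegrable w volume)
    (hwp_loc : LocallyIntegrable (fun t => w t ^ p) volume)
    (hw_pos : ∀ᵐ t ∂(volume : Measure ℝ), 0 < w t)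
    -- `[w]_{RH_p^d(J)} = δ` : `δ` is the supremum over dyadic subintervals `I ∈ D(J)`
    -- of `⟨w^p⟩_I^(1/p) / ⟨w⟩_I`
    (hRH : IsLUB {r : ℝ | ∃ j m : ℕ, m < 2 ^ j ∧
      r = (avg (fun t => w t ^ p) (N * 2 ^ j + m) (K + j)) ^ (1 / p) /
            avg w (N * 2 ^ j + m) (K + j)} δ)
    -- `Db^d(w) = Q0` : `Q0` is the supremum of `⟨w⟩_{I*}/⟨w⟩_I` over dyadic intervals `I`
    (hDb : IsLUB {r : ℝ | ∃ n k : ℕ, r = avg w (n / 2) k / avg w n (k + 1)} Q0)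
    (hQ : Q = max Q0 2)
    (hH : H = (Q ^ p - 1) / (Q - 1))
    (hε : ε = H / p * ((p - 1) / (H - 1)) ^ ((p - 1) / p) * δ)
    (hsm_neg : sm ≤ 0)
    (hsm : (1 - p * sm) ^ (1 / p) * (1 - sm)⁻¹ = 1 / ε) :
    ∀ q : ℝ, 1 - p * sm < q → ∀ j m : ℕ, m < 2 ^ j →
      IntegrableOn (fun t => w t ^ (-(p / (q - 1)))) (dIcc (N * 2 ^ j + m) (K + j)) volume ∧
      avg (fun t => w t ^ p) (N * 2 ^ j + m) (K + j) *
          (avg (fun t => w t ^ (-(p / (q - 1)))) (N * 2 ^ j + m) (K + j)) ^ (q - 1)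
        ≤ ((q - 1) / (q - 1 + p * sm)) ^ (q - 1) := by
  intro q hq j m hm
  have hp0 : 0 < p := by linarith
  have hp1 : 0 < p - 1 := by linarith
  have hps : p * sm ≤ 0 := mul_nonpos_of_nonneg_of_nonpos hp0.le hsm_neg
  have hq1 : 0 < q - 1 := by linarith
  have hqs : 0 < q - 1 + p * sm := by linarith
  have hQ2 : 2 ≤ Q := hQ ▸ le_max_right _ _
  have hQ0 : Q0 ≤ Q := hQ ▸ le_max_left _ _
  have hHp : p < H := hH ▸ H_gt hp hQ2
  have hH1 : 0 < H - 1 := by linarith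
  have hH0 : 0 < H := by linarith
  have hx1 := avg_pos hw_loc hw_pos
  have hJ := avg_jensen hp hw_loc hwp_loc hw_pos
  have hx2 : ∀ n k, 0 < avg (fun t => w t ^ p) n k := fun n k =>
    (Real.rpow_pos_of_pos (hx1 n k) p).trans_le (hJ n k)
  have hδ : 0 < δ := by
    have h := hRH.1 ⟨0, 0, by norm_num, rfl⟩
    refine lt_of_lt_of_le ?_ h
    exact div_pos (Real.rpow_pos_of_pos (hx2 _ _) _) (hx1 _ _)
  have hR : ∀ j m : ℕ, m < 2 ^ j → avg (fun t => w t ^ p) (N * 2 ^ j + m) (K + j) ≤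
      δ ^ p * avg w (N * 2 ^ j + m) (K + j) ^ p := by
    intro j m hm
    have h := hRH.1 ⟨j, m, hm, rfl⟩
    rw [div_le_iff₀ (hx1 _ _)] at h
    have h' := Real.rpow_le_rpow (Real.rpow_nonneg (hx2 _ _).le _) h hp0.le
    rwa [← Real.rpow_mul (hx2 _ _).le, one_div_mul_cancel hp0.ne', Real.rpow_one,
      Real.mul_rpow hδ.le (hx1 _ _).le] at h'
  have hdb : ∀ n k, avg w (n / 2) k ≤ Q * avg w n (k + 1) := by
    intro n k
    have h := hDb.1 ⟨n, k, rfl⟩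
    rw [div_le_iff₀ (hx1 _ _)] at h
    exact h.trans (mul_le_mul_of_nonneg_right hQ0 (hx1 _ _).le)
  have hε0 : 0 < ε := by
    rw [hε]; positivity
  set r := -(p / (q - 1)) with hr_def
  have hr : r < 0 := by rw [hr_def]; exact neg_neg_of_pos (by positivity)
  have hE : ε ^ p = ((H / p) ^ p * ((p - 1) / (H - 1)) ^ (p - 1)) * δ ^ p := by
    rw [hε, Real.mul_rpow (by positivity) hδ.le, Real.mul_rpow (by positivity) (by positivity),
      ← Real.rpow_mul (by positivity), div_mul_cancel₀ _ hp0.ne']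
  have hκ : 1 ≤ 1 - sm := by linarith
  have hκE : (1 - sm) ^ p = ε ^ p * (p * (1 - sm) - (p - 1)) := by
    have h1 : (1 - p * sm) ^ (1 / p) * ε = 1 - sm := by
      field_simp at hsm
      linarith
    rw [← h1, Real.mul_rpow (Real.rpow_nonneg (by linarith) _) hε0.le,
      ← Real.rpow_mul (by linarith), one_div_mul_cancel hp0.ne', Real.rpow_one, h1]
    ring
  have hCeq : (1 + r * (1 - sm - 1))⁻¹ = (q - 1) / (q - 1 + p * sm) := by
    rw [inv_eq_one_div, div_eq_div_iff]
    · rw [hr_def]; field_simp; ring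
    · have : 1 + r * (1 - sm - 1) = (q - 1 + p * sm) / (q - 1) := by
        rw [hr_def]; field_simp; ring
      rw [this]; positivity
    · exact hqs.ne'
  have hC : 0 < 1 + r * (1 - sm - 1) := by
    rw [← inv_pos, hCeq]; positivity
  obtain ⟨B, hB1, hB2⟩ := bellman hp hr hκ (Real.rpow_pos_of_pos hδ p) hQ2 hH rfl hE hκE hC
  have hstep := step_bound (g := avg w)
    (b := fun n k => B (avg w n k) (avg (fun t => w t ^ p) n k))
    (P := fun n k => ∃ j m : ℕ, m < 2 ^ j ∧ n = N * 2 ^ j + m ∧ k = K + j) (r := r) ?_ ?_ ?_ ?_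
  · have hb := hB1 _ _ (hx1 (N * 2 ^ j + m) (K + j)) (hJ _ _) (hR j m hm)
    obtain ⟨hint, hle⟩ := limit_bound hw_loc hw_pos (N * 2 ^ j + m) (K + j)
      ((Real.rpow_nonneg (hx1 _ _).le r).trans hb.1)
      (fun d => hstep d _ _ ⟨j, m, hm, rfl, rfl⟩)
    refine ⟨hint, ?_⟩
    have hX := hx2 (N * 2 ^ j + m) (K + j)
    set X := avg (fun t => w t ^ p) (N * 2 ^ j + m) (K + j)
    have h3 := hle.trans hb.2
    rw [hCeq] at h3
    have h0 : 0 ≤ avg (fun t => w t ^ r) (N * 2 ^ j + m) (K + j) := by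
      rw [avg]
      refine mul_nonneg (by positivity) (integral_nonneg_of_ae ?_)
      exact ae_restrict_of_ae (hw_pos.mono fun t ht => Real.rpow_nonneg ht.le r)
    have h4 := Real.rpow_le_rpow h0 h3 hq1.le
    rw [Real.mul_rpow (by positivity) (by positivity), ← Real.rpow_mul hX.le] at h4
    have e : r / p * (q - 1) = -1 := by rw [hr_def]; field_simp
    rw [e, Real.rpow_neg_one] at h4
    calc _ ≤ X * (((q - 1) / (q - 1 + p * sm)) ^ (q - 1) * X⁻¹) := by gcongr
      _ = _ := by field_simp
  · rintro n k ⟨j, m, hm, rfl, rfl⟩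
    refine ⟨⟨j + 1, 2 * m, by rw [pow_succ]; omega, by ring, by ring⟩,
      ⟨j + 1, 2 * m + 1, by rw [pow_succ]; omega, by ring, by ring⟩⟩
  · rintro n k ⟨j, m, hm, rfl, rfl⟩
    exact (Real.rpow_nonneg (hx1 _ _).le r).trans (hB1 _ _ (hx1 _ _) (hJ _ _) (hR j m hm)).1
  · rintro n k ⟨j, m, hm, rfl, rfl⟩
    exact (hB1 _ _ (hx1 _ _) (hJ _ _) (hR j m hm)).1
  · rintro n k ⟨j, m, hm, rfl, rfl⟩
    have c1 := hR (j + 1) (2 * m) (by rw [pow_succ]; omega)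
    have c2 := hR (j + 1) (2 * m + 1) (by rw [pow_succ]; omega)
    have n1 : N * 2 ^ (j + 1) + 2 * m = 2 * (N * 2 ^ j + m) := by ring
    have n2 : N * 2 ^ (j + 1) + (2 * m + 1) = 2 * (N * 2 ^ j + m) + 1 := by ring
    rw [n1, ← add_assoc] at c1
    rw [n2, ← add_assoc] at c2
    have d1 := hdb (2 * (N * 2 ^ j + m)) (K + j)
    have d2 := hdb (2 * (N * 2 ^ j + m) + 1) (K + j)
    rw [show 2 * (N * 2 ^ j + m) / 2 = N * 2 ^ j + m by omega] at d1
    rw [show (2 * (N * 2 ^ j + m) + 1) / 2 = N * 2 ^ j + m by omega] at d2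
    exact hB2 _ _ _ _ _ _ (avg_split hw_loc _ _) (avg_split hwp_loc _ _) (hx1 _ _) (hJ _ _)
      (hR j m hm) (hx1 _ _) (hJ _ _) c1 (hx1 _ _) (hJ _ _) c2 d1 d2
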